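/- Let Ψ be a planar-monotone-style CNF instance with n variables in which every clause has |L_h| ∈ {2,3}, and let G'_Ψ be the associated power-domination graph. If S is a power dominating set of G'_Ψ with cardinality exactly n, then for every variable i the intersection of S with the six-element set {v_i, v̄_i, u_i, v'_i, v̄'_i, u'_i} has exactly one element, and moreover Ψ is satisfiable. -/

import Mathlib

/-- A planar-monotone-style CNF instance with `n` variables and `m` clauses:
clause `h` consists of the set of variable indices `L h` together with a sign
`eps h` (`true` = all literals unnegated, `false` = all negated). -/
structure PMCnf (n m : ℕ) where
  L : Fin m → Finset (Fin n)
  eps : Fin m → Bool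

/-- An assignment `a` satisfies `Ψ` if every clause contains a variable whose
value agrees with the sign of the clause. -/
def PMCnf.Satisfies {n m : ℕ} (Ψ : PMCnf n m) (a : Fin n → Bool) : Prop :=
  ∀ h : Fin m, ∃ i ∈ Ψ.L h, a i = Ψ.eps h

/-- The closed neighborhood `Γ(S)` of a set of vertices. -/
def closedNbhd {V : Type*} (G : SimpleGraph V) (S : Set V) : Set V :=
  S ∪ {v | ∃ s ∈ S, G.Adj v s}

/-- `S` is a dominating set if `Γ(S) = V`. -/
def IsDominating {V : Type*} (G : SimpleGraph V) (S : Set V) : Prop :=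
  closedNbhd G S = Set.univ

/-- `S₁(A)`: the vertices of `A` having exactly one neighbor outside `A`. -/
def pdS1 {V : Type*} (G : SimpleGraph V) (A : Set V) : Set V :=
  {s ∈ A | ∃! v, v ∉ A ∧ G.Adj s v}

/-- The propagation operator `Γ₁(A) = A ∪ Γ(S₁(A))`. -/
def pdStep {V : Type*} (G : SimpleGraph V) (A : Set V) : Set V :=
  A ∪ closedNbhd G (pdS1 G A)

/-- `S` is a power dominating set if iterating `Γ₁` starting from `Γ(S)`
eventually covers all vertices. -/
def IsPowerDominating {V : Type*} (G : SimpleGraph V) (S : Set V) : Prop :=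
  ∃ k : ℕ, (pdStep G)^[k] (closedNbhd G S) = Set.univ

/-- Validity predicate for clause-gadget vertices of `G'_Ψ`: `(h, Sum.inl l)`
is the vertex `z_{h,l}` (requires `l ∈ L h`), and `(h, Sum.inr 0)`,
`(h, Sum.inr 1)` are the vertices `z_{h,h}`, `v_{h,h}` (present only when
clause `h` has exactly two literals). -/
def ClauseOk {n m : ℕ} (Ψ : PMCnf n m) : Fin m × (Fin n ⊕ Fin 2) → Prop
  | (h, Sum.inl l) => l ∈ Ψ.L h
  | (h, Sum.inr _) => (Ψ.L h).card = 2

/-- Vertices of the power-domination graph `G'_Ψ`: for each variable `i` the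
six vertices `v_i = (i,0)`, `v̄_i = (i,1)`, `u_i = (i,2)`, `v'_i = (i,3)`,
`v̄'_i = (i,4)`, `u'_i = (i,5)`, together with the clause-gadget vertices. -/
abbrev PVert {n m : ℕ} (Ψ : PMCnf n m) :=
  (Fin n × Fin 6) ⊕ {p : Fin m × (Fin n ⊕ Fin 2) // ClauseOk Ψ p}

/-- The base relation generating the edges of `G'_Ψ`.
* Within a variable gadget, `(i,a)` and `(i,b)` are adjacent iff
  `a ≢ b (mod 3)`, i.e. all pairs except `(v_i,v'_i)`, `(v̄_i,v̄'_i)`,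
  `(u_i,u'_i)` (and loops) are edges.
* A clause-gadget vertex of clause `h` with slot `q` is adjacent to the
  literal vertex `w_i` (`= v_i` or `v̄_i` according to `eps h`) for each
  `i ∈ L h`, except that `z_{h,l}` is not adjacent to `w_l` itself.
* Two clause-gadget vertices are adjacent iff they belong to the same clause,
  are distinct, and are not the pair `(z_{h,h}, v_{h,h})`. -/
def pdRel {n m : ℕ} (Ψ : PMCnf n m) : PVert Ψ → PVert Ψ → Prop
  | Sum.inl (i, a), Sum.inl (j, b) => i = j ∧ a.val % 3 ≠ b.val % 3
  | Sum.inl (i, a), Sum.inr ⟨(h, q), _⟩ =>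
      a = (if Ψ.eps h then 0 else 1) ∧ i ∈ Ψ.L h ∧ ∀ l, q = Sum.inl l → l ≠ i
  | Sum.inr ⟨(h, q), _⟩, Sum.inl (i, a) =>
      a = (if Ψ.eps h then 0 else 1) ∧ i ∈ Ψ.L h ∧ ∀ l, q = Sum.inl l → l ≠ i
  | Sum.inr ⟨(h, q), _⟩, Sum.inr ⟨(h', q'), _⟩ =>
      h = h' ∧ q ≠ q' ∧ (q.isLeft = true ∨ q'.isLeft = true)

/-- The power-domination graph `G'_Ψ` associated to the CNF instance `Ψ`. -/
def pdGraph {n m : ℕ} (Ψ : PMCnf n m) : SimpleGraph (PVert Ψ) :=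
  SimpleGraph.fromRel (pdRel Ψ)

/-- The literal vertex `w_l` of clause `h`: `v_l` if `eps h = true`,
`v̄_l` if `eps h = false`. -/
def wV {n m : ℕ} (Ψ : PMCnf n m) (h : Fin m) (l : Fin n) : PVert Ψ :=
  Sum.inl (l, if Ψ.eps h then 0 else 1)

/-- The clause-gadget vertex `z_{h,l}` (for `l ∈ L h`). -/
def zV {n m : ℕ} (Ψ : PMCnf n m) (h : Fin m) (l : Fin n) (hl : l ∈ Ψ.L h) :
    PVert Ψ :=
  Sum.inr ⟨(h, Sum.inl l), hl⟩

/-- The clause-gadget vertex `z_{h,h}` (for a clause with two literals). -/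
def zhhV {n m : ℕ} (Ψ : PMCnf n m) (h : Fin m) (hc : (Ψ.L h).card = 2) :
    PVert Ψ :=
  Sum.inr ⟨(h, Sum.inr 0), hc⟩

/-- The clause-gadget vertex `v_{h,h}` (for a clause with two literals). -/
def vhhV {n m : ℕ} (Ψ : PMCnf n m) (h : Fin m) (hc : (Ψ.L h).card = 2) :
    PVert Ψ :=
  Sum.inr ⟨(h, Sum.inr 1), hc⟩

/-- A nonempty set `B` such that no outside vertex has exactly one neighbor in `B` (a fort)
must meet the closed neighborhood of every power dominating set. -/
theorem IsPowerDominating.exists_mem_closedNbhd_of_fort {V : Type*} {G : SimpleGraph V}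
    {S B : Set V} (hS : IsPowerDominating G S) (hne : B.Nonempty)
    (hB : ∀ s ∉ B, ∀ x ∈ B, G.Adj s x → ∃ y ∈ B, y ≠ x ∧ G.Adj s y) :
    ∃ x ∈ B, x ∈ closedNbhd G S := by
  by_contra! hdisj
  obtain ⟨k, hk⟩ := hS
  have key : ∀ k : ℕ, ∀ x ∈ B, x ∉ (pdStep G)^[k] (closedNbhd G S) := by
    intro k
    induction k with
    | zero => exact hdisj
    | succ k ih =>
      intro x hx hmem
      rw [Function.iterate_succ_apply'] at hmem
      rcases hmem with hmem | hmem | ⟨s, ⟨hsA, v, -, huniq⟩, hadj⟩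
      · exact ih x hx hmem
      · exact ih x hx hmem.1
      · obtain ⟨y, hy, hyx, hsy⟩ := hB s (fun hs => ih s hs hsA) x hx hadj.symm
        exact hyx ((huniq y ⟨ih y hy, hsy⟩).trans (huniq x ⟨ih x hx, hadj.symm⟩).symm)
  obtain ⟨x, hx⟩ := hne
  exact key k x hx (hk ▸ Set.mem_univ x)

theorem pdGraph_adj_inl_inl {n m : ℕ} (Ψ : PMCnf n m) (i j : Fin n) (a b : Fin 6) :
    (pdGraph Ψ).Adj (Sum.inl (i, a)) (Sum.inl (j, b)) ↔ i = j ∧ a.val % 3 ≠ b.val % 3 := by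
  simp only [pdGraph, SimpleGraph.fromRel_adj, pdRel]
  grind

theorem pdGraph_adj_inl_inr {n m : ℕ} (Ψ : PMCnf n m) (i : Fin n) (a : Fin 6) (h : Fin m)
    (q : Fin n ⊕ Fin 2) (hq : ClauseOk Ψ (h, q)) :
    (pdGraph Ψ).Adj (Sum.inl (i, a)) (Sum.inr ⟨(h, q), hq⟩) ↔
      a = (if Ψ.eps h then 0 else 1) ∧ i ∈ Ψ.L h ∧ ∀ l, q = Sum.inl l → l ≠ i := by
  simp [pdGraph, SimpleGraph.fromRel_adj, pdRel]

theorem pdGraph_adj_inr_inr {n m : ℕ} (Ψ : PMCnf n m)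
    (p p' : {p : Fin m × (Fin n ⊕ Fin 2) // ClauseOk Ψ p})
    (hadj : (pdGraph Ψ).Adj (Sum.inr p) (Sum.inr p')) : p.1.1 = p'.1.1 := by
  obtain ⟨⟨h, q⟩, hq⟩ := p
  obtain ⟨⟨h', q'⟩, hq'⟩ := p'
  simp only [pdGraph, SimpleGraph.fromRel_adj, pdRel] at hadj
  grind

/-- Every power dominating set contains a vertex of each variable gadget. -/
theorem pdGraph_exists_mem_gadget {n m : ℕ} (Ψ : PMCnf n m) {S : Set (PVert Ψ)}
    (hS : IsPowerDominating (pdGraph Ψ) S) (i : Fin n) :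
    ∃ c : Fin 6, Sum.inl (i, c) ∈ S := by
  obtain ⟨x, ⟨c, hc, rfl⟩, hx⟩ := hS.exists_mem_closedNbhd_of_fort
    (B := {x | ∃ c : Fin 6, 2 ≤ c ∧ x = Sum.inl (i, c)}) ⟨_, 2, le_rfl, rfl⟩ (by
      rintro (⟨j, a⟩ | ⟨⟨h, q⟩, hq⟩) hs x ⟨c, hc, rfl⟩ hadj
      · obtain ⟨rfl, -⟩ := (pdGraph_adj_inl_inl ..).1 hadj
        have ha : a < 2 := by
          by_contra! ha
          exact hs ⟨a, ha, rfl⟩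
        have hd : ∃ d : Fin 6, 2 ≤ d ∧ d ≠ c ∧ a.val % 3 ≠ d.val % 3 := by
          clear hs hadj
          revert a c
          decide
        obtain ⟨d, hd, hdc, had⟩ := hd
        exact ⟨_, ⟨d, hd, rfl⟩, by simpa using hdc, (pdGraph_adj_inl_inl ..).2 ⟨rfl, had⟩⟩
      · have := ((pdGraph_adj_inl_inr ..).1 hadj.symm).1
        split_ifs at this <;> subst this <;> exact absurd hc (by decide))
  rcases hx with hx | ⟨⟨j, a⟩ | ⟨⟨h, q⟩, hq⟩, hs, hadj⟩
  · exact ⟨c, hx⟩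
  · obtain ⟨rfl, -⟩ := (pdGraph_adj_inl_inl ..).1 hadj
    exact ⟨a, hs⟩
  · have := ((pdGraph_adj_inl_inr ..).1 hadj).1
    split_ifs at this <;> subst this <;> exact absurd hc (by decide)

/-- For every clause, a power dominating set contains a vertex of its clause gadget
or one of its literal vertices. -/
theorem pdGraph_exists_mem_clause {n m : ℕ} (Ψ : PMCnf n m) {S : Set (PVert Ψ)}
    (hS : IsPowerDominating (pdGraph Ψ) S) (h : Fin m)
    (hsz : (Ψ.L h).card = 2 ∨ (Ψ.L h).card = 3) :
    (∃ p, Sum.inr p ∈ S) ∨ ∃ i ∈ Ψ.L h, wV Ψ h i ∈ S := by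
  obtain ⟨l, hl⟩ : (Ψ.L h).Nonempty := Finset.card_pos.1 (by omega)
  obtain ⟨x, ⟨q, hq, rfl⟩, hx⟩ := hS.exists_mem_closedNbhd_of_fort
    (B := {x | ∃ q, ∃ hq : ClauseOk Ψ (h, q), x = Sum.inr ⟨(h, q), hq⟩})
    ⟨zV Ψ h l hl, _, _, rfl⟩ (by
      rintro (⟨i, a⟩ | ⟨⟨h', q'⟩, hq'⟩) hs x ⟨q, hq, rfl⟩ hadj
      · obtain ⟨ha, hi, -⟩ := (pdGraph_adj_inl_inr ..).1 hadj
        suffices hr : ∃ r, ClauseOk Ψ (h, r) ∧ r ≠ q ∧ ∀ l, r = Sum.inl l → l ≠ i by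
          obtain ⟨r, hr, hrq, hri⟩ := hr
          exact ⟨_, ⟨r, hr, rfl⟩, by simpa using hrq,
            (pdGraph_adj_inl_inr ..).2 ⟨ha, hi, hri⟩⟩
        rcases hsz with hsz | hsz
        · by_cases h0 : q = Sum.inr 0
          · exact ⟨Sum.inr 1, hsz, by simp [h0], by simp⟩
          · exact ⟨Sum.inr 0, hsz, Ne.symm h0, by simp⟩
        · have hcard : ((Ψ.L h).erase i).card = 2 := by
            rw [Finset.card_erase_of_mem hi, hsz]
          obtain ⟨j, k, hjk, hE⟩ := Finset.card_eq_two.1 hcard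
          have hj : j ∈ (Ψ.L h).erase i := by simp [hE]
          have hk : k ∈ (Ψ.L h).erase i := by simp [hE]
          rw [Finset.mem_erase] at hj hk
          by_cases h0 : q = Sum.inl j
          · exact ⟨Sum.inl k, hk.2, by simpa [h0] using hjk.symm, by simpa using hk.1⟩
          · exact ⟨Sum.inl j, hj.2, Ne.symm h0, by simpa using hj.1⟩
      · obtain rfl : h' = h := pdGraph_adj_inr_inr _ _ _ hadj
        exact absurd ⟨q', hq', rfl⟩ hs)
  rcases hx with hx | ⟨⟨i, a⟩ | p, hs, hadj⟩
  · exact Or.inl ⟨_, hx⟩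
  · obtain ⟨rfl, hi, -⟩ := (pdGraph_adj_inl_inr ..).1 hadj.symm
    exact Or.inr ⟨i, hi, hs⟩
  · exact Or.inl ⟨p, hs⟩

/-- If `S` is a power dominating set of `G'_Ψ` of cardinality
exactly `n`, then `S` meets each six-element variable gadget in exactly one
element, and `Ψ` is satisfiable. -/
theorem pdGraph_powerDominating_card_eq {n m : ℕ} (Ψ : PMCnf n m)
    (hsz : ∀ h : Fin m, (Ψ.L h).card = 2 ∨ (Ψ.L h).card = 3)
    (S : Set (PVert Ψ)) (hS : IsPowerDominating (pdGraph Ψ) S)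
    (hcard : S.ncard = n) :
    (∀ i : Fin n,
      (S ∩ {x : PVert Ψ | ∃ c : Fin 6, x = Sum.inl (i, c)}).ncard = 1) ∧
      ∃ a : Fin n → Bool, Ψ.Satisfies a := by
  choose c hc using pdGraph_exists_mem_gadget Ψ hS
  have hinj : Function.Injective (fun i => (Sum.inl (i, c i) : PVert Ψ)) := by
    intro i j hij
    simpa using (Prod.ext_iff.1 (Sum.inl_injective hij)).1
  have hrange : Set.range (fun i => (Sum.inl (i, c i) : PVert Ψ)) = S := by
    refine Set.eq_of_subset_of_ncard_le (Set.range_subset_iff.2 hc) ?_ (Set.toFinite S)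
    rw [hcard, ← Set.image_univ, Set.ncard_image_of_injective _ hinj, Set.ncard_univ,
      Nat.card_fin]
  have hmem : ∀ i d, Sum.inl (i, d) ∈ S ↔ d = c i := by
    intro i d
    rw [← hrange]
    constructor
    · rintro ⟨j, hj⟩
      simp only [Sum.inl.injEq, Prod.mk.injEq] at hj
      obtain ⟨rfl, rfl⟩ := hj
      rfl
    · rintro rfl
      exact ⟨i, rfl⟩
  have hinr : ∀ p, Sum.inr p ∉ S := by
    intro p
    simp [← hrange]
  refine ⟨fun i => Set.ncard_eq_one.2 ⟨Sum.inl (i, c i), ?_⟩, fun i => decide (c i = 0), ?_⟩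
  · ext x
    constructor
    · rintro ⟨hx, d, rfl⟩
      rw [(hmem i d).1 hx]
      rfl
    · rintro rfl
      exact ⟨hc i, c i, rfl⟩
  · intro h
    rcases pdGraph_exists_mem_clause Ψ hS h (hsz h) with ⟨p, hp⟩ | ⟨i, hi, hw⟩
    · exact absurd hp (hinr p)
    · refine ⟨i, hi, ?_⟩
      have hw' := (hmem i _).1 hw
      cases hε : Ψ.eps h <;> simp [hε] at hw' <;> simp [← hw']
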